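/- Let α > 0, let r satisfy 0 < r ≤ α, and let ρ satisfy 0 < ρ ≤ r/2. Set h₁ = ρ(2α−ρ)/(2(α+r−ρ)), 𝒞(h₁) = {x ∈ ℝ² : −h₁ ≤ ⟨x,e₂⟩ ≤ 0} ∩ B(−r e₂, r), Q₁ = {(x₁,x₂) ∈ ℝ² : x₁ ≥ 0} and Q₂ = {(x₁,x₂) ∈ ℝ² : x₁ ≤ 0}. Then for every y ∈ ℱ_r there exists i ∈ {1,2} such that Qᵢ ∩ 𝒞(h₁) ⊆ B(y,r) and μ((Qᵢ ∩ 𝒞(h₁)) ∩ B((α−ρ)e₂, α)) ≥ (√2/6)·r^{1/2}·ρ^{3/2}. -/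

import Mathlib

open MeasureTheory Metric Set
open scoped RealInnerProductSpace ENNReal

noncomputable section

/-- The Euclidean plane. -/
abbrev E2 := EuclideanSpace ℝ (Fin 2)

/-- The point `(a, b)` of the Euclidean plane. -/
def pt (a b : ℝ) : E2 := (WithLp.equiv 2 (Fin 2 → ℝ)).symm ![a, b]

/-- The unit vector `e₂ = (0, 1)`. -/
def e₂ : E2 := pt 0 1

/-- `𝒞(h) = {x : −h ≤ ⟪x, e₂⟫ ≤ 0} ∩ B(−r e₂, r)`. -/
def Cset (h r : ℝ) : Set E2 :=
  {x : E2 | -h ≤ ⟪x, e₂⟫ ∧ ⟪x, e₂⟫ ≤ 0} ∩ closedBall (-(r • e₂)) r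

/-- `ℱ_r = {y ∈ B(0,r) : ⟪y, e₂⟫ < −‖y‖/2}`. -/
def Fset (r : ℝ) : Set E2 := {y ∈ closedBall (0 : E2) r | ⟪y, e₂⟫ < -(‖y‖ / 2)}

/-- The right half-plane `Q₁`. -/
def Q1 : Set E2 := {x : E2 | 0 ≤ x 0}

/-- The left half-plane `Q₂`. -/
def Q2 : Set E2 := {x : E2 | x 0 ≤ 0}

lemma inner_e₂ (x : E2) : ⟪x, e₂⟫ = x 1 := by
  simp [e₂, pt, PiLp.inner_apply, Fin.sum_univ_two]

lemma mem_ball_iff (x y : E2) (r : ℝ) (hr : 0 ≤ r) :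
    x ∈ closedBall y r ↔ (x 0 - y 0) ^ 2 + (x 1 - y 1) ^ 2 ≤ r ^ 2 := by
  rw [mem_closedBall, EuclideanSpace.dist_eq, Real.sqrt_le_left hr]
  simp [Fin.sum_univ_two, Real.dist_eq, sq_abs]

lemma mp_swap : MeasurePreserving (fun x : E2 => ((x 1, x 0) : ℝ × ℝ)) volume volume := by
  have h1 := EuclideanSpace.volume_preserving_symm_measurableEquiv_toLp (Fin 2)
  have h2 := volume_preserving_finTwoArrow ℝ
  have h3 : MeasurePreserving (Prod.swap : ℝ × ℝ → ℝ × ℝ) volume volume :=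
    Measure.measurePreserving_swap
  exact h3.comp (h2.comp h1)

/-- Geometric core: `u` horizontal, `w` depth, `(a, -c)` the centre, `n` its norm. -/
lemma core (r u w a c n : ℝ) (hr : 0 < r) (hu : 0 ≤ u) (hw : 0 ≤ w) (hwr : w ≤ r / 2)
    (hm : u ^ 2 + w ^ 2 ≤ 2 * r * w) (ha : 0 ≤ a) (hn : 0 ≤ n) (hnr : n ≤ r)
    (hac : a ^ 2 + c ^ 2 = n ^ 2) (hc : n / 2 ≤ c) :
    (u - a) ^ 2 + (w - c) ^ 2 ≤ r ^ 2 := by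
  have hcn : c ≤ n := by nlinarith [sq_nonneg a]
  have key : n * (u ^ 2 + w ^ 2) ≤ 2 * (u * a + w * c) * r := by
    by_cases h : w ^ 2 ≤ 3 * u ^ 2
    · have h1 : w * (n - c) ≤ u * a := by
        apply le_of_sq_le_sq _ (by positivity)
        have h2 : 3 * (n - c) ^ 2 ≤ a ^ 2 := by nlinarith
        have h3 : w ^ 2 * (3 * (n - c) ^ 2) ≤ (3 * u ^ 2) * a ^ 2 := by
          gcongr
        nlinarith
      nlinarith [mul_le_mul_of_nonneg_left hm hn, mul_le_mul_of_nonneg_left h1 hr.le]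
    · push Not at h
      have h1 : u ^ 2 + w ^ 2 ≤ r * w := by nlinarith
      have h2 : 0 ≤ u * a * r := by positivity
      have h3 : w * r * (n / 2) ≤ w * r * c := by gcongr
      nlinarith [mul_le_mul_of_nonneg_left h1 hn]
  have hm2 : u ^ 2 + w ^ 2 ≤ r ^ 2 := by nlinarith
  have h5 : (u ^ 2 + w ^ 2) * (r - n) ≤ r ^ 2 * (r - n) :=
    mul_le_mul_of_nonneg_right hm2 (by linarith)
  have h6 : 0 ≤ r * n * (r - n) := by
    have : 0 ≤ r - n := by linarith
    positivity
  have : ((u - a) ^ 2 + (w - c) ^ 2) * r ≤ r ^ 2 * r := by nlinarith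
  exact le_of_mul_le_mul_right this hr

lemma int_val (r ρ : ℝ) (hr : 0 < r) (hρ : 0 < ρ) :
    ∫ v in Ioc (-(ρ / 2)) 0, Real.sqrt (r * -v)
      = Real.sqrt 2 / 6 * r ^ ((1 : ℝ) / 2) * ρ ^ ((3 : ℝ) / 2) := by
  rw [← intervalIntegral.integral_of_le (by linarith),
    intervalIntegral.integral_comp_neg (fun v => Real.sqrt (r * v))]
  simp only [Real.sqrt_mul hr.le, neg_neg, neg_zero, intervalIntegral.integral_const_mul]
  simp only [Real.sqrt_eq_rpow]
  rw [integral_rpow (by left; norm_num), Real.zero_rpow (by norm_num),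
    show (1 / 2 + 1 : ℝ) = 3 / 2 by norm_num, Real.div_rpow hρ.le (by norm_num),
    show (2 : ℝ) ^ (3 / 2 : ℝ) = 2 * 2 ^ (1 / 2 : ℝ) by
      rw [show (3 / 2 : ℝ) = 1 + 1 / 2 by norm_num, Real.rpow_add (by norm_num), Real.rpow_one],
    ← Real.sqrt_eq_rpow 2]
  have h2 : Real.sqrt 2 ^ 2 = 2 := Real.sq_sqrt (by norm_num)
  have : Real.sqrt 2 ≠ 0 := by positivity
  field_simp
  rw [h2]
  ring

lemma vol_val (r ρ : ℝ) (hr : 0 < r) (hρ : 0 < ρ) (f g : ℝ → ℝ) (hf : Continuous f)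
    (hg : Continuous g) (hfg : ∀ v, g v - f v = Real.sqrt (r * -v)) (S : Set E2)
    (hS : ∀ x : E2, -(ρ / 2) < x 1 → x 1 ≤ 0 → f (x 1) < x 0 → x 0 < g (x 1) → x ∈ S) :
    ENNReal.ofReal (Real.sqrt 2 / 6 * r ^ ((1 : ℝ) / 2) * ρ ^ ((3 : ℝ) / 2)) ≤ volume S := by
  have hi : ∀ k : ℝ → ℝ, Continuous k → IntegrableOn k (Ioc (-(ρ / 2)) 0) volume :=
    fun k hk => (hk.integrableOn_Icc).mono_set Ioc_subset_Icc_self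
  have h := volume_regionBetween_eq_integral (μ := volume) (hi f hf) (hi g hg) measurableSet_Ioc
    (fun v _ => by have := hfg v; have := Real.sqrt_nonneg (r * -v); linarith)
  have h2 : (∫ v in Ioc (-(ρ / 2)) 0, (g - f) v) =
      Real.sqrt 2 / 6 * r ^ ((1 : ℝ) / 2) * ρ ^ ((3 : ℝ) / 2) := by
    rw [← int_val r ρ hr hρ]
    simp only [Pi.sub_apply, hfg]
  rw [h2] at h
  rw [← h, ← Measure.volume_eq_prod, ← mp_swap.measure_preimage
    (measurableSet_regionBetween hf.measurable hg.measurable measurableSet_Ioc).nullMeasurableSet]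
  apply measure_mono
  intro x hx
  simp only [regionBetween, mem_preimage, mem_setOf_eq, mem_Ioc, mem_Ioo] at hx
  exact hS x hx.1.1 hx.1.2 hx.2.1 hx.2.2

lemma mem_target (α r ρ : ℝ) (hα : 0 < α) (hr : 0 < r) (hrα : r ≤ α) (hρ : 0 < ρ)
    (hρr : ρ ≤ r / 2) (h₁ : ℝ) (hh₁ : h₁ = ρ * (2 * α - ρ) / (2 * (α + r - ρ)))
    (x : E2) (hx1 : -(ρ / 2) < x 1) (hx2 : x 1 ≤ 0) (hx : (x 0) ^ 2 ≤ r * -(x 1)) :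
    x ∈ Cset h₁ r ∧ x ∈ closedBall ((α - ρ) • e₂) α := by
  have hh : ρ / 2 ≤ h₁ := by
    rw [hh₁, le_div_iff₀ (by linarith)]
    nlinarith
  have hd : h₁ * (2 * (α + r - ρ)) = ρ * (2 * α - ρ) := by
    rw [hh₁, div_mul_cancel₀]
    linarith
  have e0 : e₂ 0 = 0 := by simp [e₂, pt]
  have e1 : e₂ 1 = 1 := by simp [e₂, pt]
  refine ⟨⟨⟨?_, ?_⟩, ?_⟩, ?_⟩
  · rw [inner_e₂]; linarith
  · rw [inner_e₂]; linarith
  · rw [mem_ball_iff _ _ _ hr.le]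
    simp [e0, e1]
    nlinarith
  · rw [mem_ball_iff _ _ _ hα.le]
    simp [e0, e1]
    have h3 : -(x 1) * (2 * (α + r - ρ)) ≤ h₁ * (2 * (α + r - ρ)) := by
      apply mul_le_mul_of_nonneg_right <;> linarith
    nlinarith

lemma Cset_coord (α r ρ : ℝ) (hr : 0 < r) (hrα : r ≤ α) (hρ : 0 < ρ)
    (hρr : ρ ≤ r / 2) (h₁ : ℝ) (hh₁ : h₁ = ρ * (2 * α - ρ) / (2 * (α + r - ρ)))
    (x : E2) (hx : x ∈ Cset h₁ r) :
    0 ≤ -(x 1) ∧ -(x 1) ≤ r / 2 ∧ (x 0) ^ 2 + (-(x 1)) ^ 2 ≤ 2 * r * -(x 1) := by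
  have hh : h₁ ≤ ρ := by
    rw [hh₁, div_le_iff₀ (by linarith)]
    nlinarith
  have e0 : e₂ 0 = 0 := by simp [e₂, pt]
  have e1 : e₂ 1 = 1 := by simp [e₂, pt]
  obtain ⟨⟨h1, h2⟩, h3⟩ := hx
  rw [inner_e₂] at h1 h2
  rw [mem_ball_iff _ _ _ hr.le] at h3
  simp [e0, e1] at h3
  refine ⟨by linarith, by linarith, by nlinarith⟩

theorem statement11
    (α r ρ : ℝ) (hα : 0 < α) (hr : 0 < r) (hrα : r ≤ α) (hρ : 0 < ρ) (hρr : ρ ≤ r / 2)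
    (h₁ : ℝ) (hh₁ : h₁ = ρ * (2 * α - ρ) / (2 * (α + r - ρ))) :
    ∀ y ∈ Fset r, ∃ Q ∈ ({Q1, Q2} : Set (Set E2)),
      Q ∩ Cset h₁ r ⊆ closedBall y r ∧
        ENNReal.ofReal (Real.sqrt 2 / 6 * r ^ ((1 : ℝ) / 2) * ρ ^ ((3 : ℝ) / 2))
          ≤ volume ((Q ∩ Cset h₁ r) ∩ closedBall ((α - ρ) • e₂) α) := by
  intro y hy
  obtain ⟨hy1, hy2⟩ := hy
  rw [inner_e₂] at hy2
  have hn : ‖y‖ ≤ r := by simpa using hy1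
  have hyn : (y 0) ^ 2 + (-(y 1)) ^ 2 = ‖y‖ ^ 2 := by
    rw [EuclideanSpace.real_norm_sq_eq]
    simp [Fin.sum_univ_two]
  have hs : ∀ x : E2, x 1 ≤ 0 → 0 ≤ r * -(x 1) :=
    fun x hx => mul_nonneg hr.le (by linarith)
  rcases le_total 0 (y 0) with h0 | h0
  · refine ⟨Q1, by simp, ?_, ?_⟩
    · rintro x ⟨hxQ, hxC⟩
      obtain ⟨k1, k2, k3⟩ := Cset_coord α r ρ hr hrα hρ hρr h₁ hh₁ x hxC
      rw [mem_ball_iff _ _ _ hr.le]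
      have := core r (x 0) (-(x 1)) (y 0) (-(y 1)) ‖y‖ hr hxQ k1 k2 k3 h0 (norm_nonneg y) hn
        hyn (by linarith)
      linarith
    · refine vol_val r ρ hr hρ (fun _ => 0) (fun v => Real.sqrt (r * -v)) (by fun_prop)
        (by fun_prop) (fun v => by simp) _ ?_
      intro x a1 a2 a3 a4
      have hx : (x 0) ^ 2 ≤ r * -(x 1) := by
        have := Real.sq_sqrt (hs x a2)
        simp only at a3 a4
        nlinarith
      have := mem_target α r ρ hα hr hrα hρ hρr h₁ hh₁ x a1 a2 hx
      exact ⟨⟨le_of_lt a3, this.1⟩, this.2⟩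
  · refine ⟨Q2, by simp, ?_, ?_⟩
    · rintro x ⟨hxQ, hxC⟩
      obtain ⟨k1, k2, k3⟩ := Cset_coord α r ρ hr hrα hρ hρr h₁ hh₁ x hxC
      rw [mem_ball_iff _ _ _ hr.le]
      have hxQ' : x 0 ≤ 0 := hxQ
      have := core r (-(x 0)) (-(x 1)) (-(y 0)) (-(y 1)) ‖y‖ hr (by linarith) k1 k2
        (by rw [neg_sq (x 0)]; exact k3) (by linarith) (norm_nonneg y) hn
        (by rw [neg_sq (y 0)]; exact hyn) (by linarith)
      linarith
    · refine vol_val r ρ hr hρ (fun v => -Real.sqrt (r * -v)) (fun _ => 0) (by fun_prop)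
        (by fun_prop) (fun v => by simp) _ ?_
      intro x a1 a2 a3 a4
      have hx : (x 0) ^ 2 ≤ r * -(x 1) := by
        have := Real.sq_sqrt (hs x a2)
        simp only at a3 a4
        nlinarith
      have := mem_target α r ρ hα hr hrα hρ hρr h₁ hh₁ x a1 a2 hx
      exact ⟨⟨le_of_lt a4, this.1⟩, this.2⟩
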